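/- Assume d_x ≥ 1 and D_x ≥ 1. Suppose ν ∈ ℕ is such that ker φ_{ν'} = 0 for every ν' < ν, and ker φ_ν is the principal ideal generated by a nonzero polynomial P ∈ K[μ_1,…,μ_r, y_0,…,y_ν] (this P is the minimal polynomial of the differential elimination ideal of the system x' = g(μ,x), y = f(μ,x)). Then for every monomial μ_1^{ℓ_1}···μ_r^{ℓ_r} y_0^{e_0}···y_ν^{e_ν} occurring in P one has Σ_{i=0}^{ν} (d_x + i·(D_x − 1))·e_i ≤ Π_{i=0}^{ν} (d_x + i·(D_x − 1)). -/

import Mathlib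

open MvPolynomial

/-- Total degree of `p` with respect to the `μ`-variables (indexed by `Sum.inl`). -/
noncomputable def degMu {K : Type*} [CommSemiring K] {r n : ℕ}
    (p : MvPolynomial (Fin r ⊕ Fin n) K) : ℕ :=
  p.support.sup fun m => ∑ j : Fin r, m (Sum.inl j)

/-- Total degree of `p` with respect to the `x`-variables (indexed by `Sum.inr`). -/
noncomputable def degXv {K : Type*} [CommSemiring K] {r n : ℕ}
    (p : MvPolynomial (Fin r ⊕ Fin n) K) : ℕ :=
  p.support.sup fun m => ∑ i : Fin n, m (Sum.inr i)

/-- The `K`-algebra homomorphism `φ_ν : K[μ_1,…,μ_r, y_0,…,y_ν] → K[μ, x]`,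
sending `μ_j ↦ μ_j` and `y_k ↦ L^k(f)`. -/
noncomputable def liePhi {K : Type*} [Field K] [CharZero K] {r n : ℕ}
    (f : MvPolynomial (Fin r ⊕ Fin n) K)
    (L : Derivation ℚ (MvPolynomial (Fin r ⊕ Fin n) K) (MvPolynomial (Fin r ⊕ Fin n) K))
    (ν : ℕ) :
    MvPolynomial (Fin r ⊕ Fin (ν + 1)) K →ₐ[K] MvPolynomial (Fin r ⊕ Fin n) K :=
  aeval (Sum.elim (fun j => X (Sum.inl j)) (fun k : Fin (ν + 1) => (⇑L)^[(k : ℕ)] f))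


/-- The vectors `e : ι → ℕ` of weighted size `∑ i, w i * e i` at most `D`, for positive weights. -/
def boundedVectors {ι : Type*} [Fintype ι] [DecidableEq ι] (w : ι → ℕ) (D : ℕ) :
    Finset (ι → ℕ) :=
  (Fintype.piFinset fun _ => Finset.range (D + 1)).filter fun e => ∑ i, w i * e i ≤ D

section Counting

variable {ι : Type*} [Fintype ι] [DecidableEq ι]

theorem mem_boundedVectors {w : ι → ℕ} (hw : ∀ i, 0 < w i) {D : ℕ} {e : ι → ℕ} :
    e ∈ boundedVectors w D ↔ ∑ i, w i * e i ≤ D := by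
  simp only [boundedVectors, Finset.mem_filter, Fintype.mem_piFinset, Finset.mem_range,
    and_iff_right_iff_imp]
  intro h i
  have h1 : w i * e i ≤ ∑ i, w i * e i :=
    Finset.single_le_sum (f := fun i => w i * e i) (fun _ _ => Nat.zero_le _) (Finset.mem_univ i)
  have h2 : e i ≤ w i * e i := Nat.le_mul_of_pos_left _ (hw i)
  omega

theorem card_boundedVectors_le_pow (w : ι → ℕ) (D : ℕ) :
    (boundedVectors w D).card ≤ (D + 1) ^ Fintype.card ι :=
  (Finset.card_filter_le _ _).trans (by simp)

theorem card_boundedVectors_one_le {w : ι → ℕ} (hw : ∀ i, 0 < w i) (D : ℕ) :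
    (boundedVectors (1 : ι → ℕ) D).card ≤ (∏ i, w i) * (boundedVectors w D).card := by
  have hc : (Fintype.piFinset fun i => Finset.range (w i)).card = ∏ i, w i := by simp
  rw [← hc, ← Finset.card_product]
  refine Finset.card_le_card_of_injOn (fun e => (fun i => e i % w i, fun i => e i / w i)) ?_ ?_
  · intro e he
    rw [Finset.mem_coe, mem_boundedVectors (by simp)] at he
    rw [Finset.mem_coe, Finset.mem_product, mem_boundedVectors hw]
    refine ⟨by simpa using fun i => Nat.mod_lt _ (hw i), le_trans ?_ he⟩
    exact Finset.sum_le_sum fun i _ => by simpa using Nat.mul_div_le (e i) (w i)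
  · intro e _ e' _ h
    simp only [Prod.mk.injEq, funext_iff] at h
    funext i
    rw [← Nat.div_add_mod (e i) (w i), ← Nat.div_add_mod (e' i) (w i), h.1 i, h.2 i]

theorem prod_mul_card_boundedVectors_le {w : ι → ℕ} (hw : ∀ i, 0 < w i) (D : ℕ) :
    (∏ i, w i) * (boundedVectors w D).card ≤
      (boundedVectors (1 : ι → ℕ) (D + ∑ i, w i)).card := by
  have hc : (Fintype.piFinset fun i => Finset.range (w i)).card = ∏ i, w i := by simp
  rw [← hc, ← Finset.card_product]
  refine Finset.card_le_card_of_injOn (fun p i => w i * p.2 i + p.1 i) ?_ ?_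
  · rintro ⟨c, e⟩ h
    rw [Finset.mem_coe, Finset.mem_product, mem_boundedVectors hw] at h
    rw [Finset.mem_coe, mem_boundedVectors (by simp)]
    simp only [Fintype.mem_piFinset, Finset.mem_range] at h
    simp only [Pi.one_apply, one_mul, Finset.sum_add_distrib]
    exact add_le_add h.2 (Finset.sum_le_sum fun i _ => (h.1 i).le)
  · rintro ⟨c, e⟩ h ⟨c', e'⟩ h' heq
    simp only [Finset.coe_product, Set.mem_prod, Finset.mem_coe, Fintype.mem_piFinset,
      Finset.mem_range] at h h'
    have hi : ∀ i, c i = c' i ∧ e i = e' i := fun i => by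
      have h0 : w i * e i + c i = w i * e' i + c' i := congrFun heq i
      have h1 := congrArg (· % w i) h0
      have h2 := congrArg (· / w i) h0
      simp only [Nat.mul_add_mod, Nat.mod_eq_of_lt (h.1 i), Nat.mod_eq_of_lt (h'.1 i)] at h1
      simp only [Nat.mul_add_div (hw i), Nat.div_eq_of_lt (h.1 i),
        Nat.div_eq_of_lt (h'.1 i)] at h2
      exact ⟨h1, by simpa using h2⟩
    exact Prod.ext (funext fun i => (hi i).1) (funext fun i => (hi i).2)

theorem card_boundedVectors_comp_equiv {κ : Type*} [Fintype κ] [DecidableEq κ] (e : κ ≃ ι)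
    (w : ι → ℕ) (hw : ∀ i, 0 < w i) (D : ℕ) :
    (boundedVectors (w ∘ e) D).card = (boundedVectors w D).card := by
  refine Finset.card_equiv (e.arrowCongr (Equiv.refl ℕ)) fun v => ?_
  rw [mem_boundedVectors (w := w ∘ e) (fun i => hw (e i)), mem_boundedVectors hw,
    ← Equiv.sum_comp e (fun i => w i * _)]
  simp

/-- Splitting off the vectors whose entry at `none` vanishes. -/
theorem card_boundedVectors_option (a : ι → ℕ) (ha : ∀ i, 0 < a i) {δ : ℕ} (hδ : 0 < δ) (D : ℕ) :
    (boundedVectors a D).card +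
        (if δ ≤ D then (boundedVectors (fun o : Option ι => o.elim δ a) (D - δ)).card else 0) ≤
      (boundedVectors (fun o : Option ι => o.elim δ a) D).card := by
  have hw : ∀ o : Option ι, 0 < o.elim δ a := by rintro (_ | i) <;> simp [hδ, ha]
  let z : (ι → ℕ) → Option ι → ℕ := fun e o => o.elim 0 e
  let s : (Option ι → ℕ) → Option ι → ℕ := fun e o => o.elim (e none + 1) fun i => e (some i)
  have hz : Function.Injective z := fun e e' h => funext fun i => congrFun h (some i)
  have hs : Function.Injective s := fun e e' h => funext fun o => by
    cases o with
    | none => simpa [s] using congrFun h none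
    | some i => exact congrFun h (some i)
  have hzm : (boundedVectors a D).image z ⊆
      (boundedVectors (fun o : Option ι => o.elim δ a) D).filter (fun e => e none = 0) := by
    intro v hv
    obtain ⟨e, he, rfl⟩ := Finset.mem_image.1 hv
    rw [mem_boundedVectors ha] at he
    rw [Finset.mem_filter, mem_boundedVectors hw]
    simpa [z, Fintype.sum_option] using he
  rw [← Finset.card_filter_add_card_filter_not (fun e : Option ι → ℕ => e none = 0)
    (s := boundedVectors (fun o : Option ι => o.elim δ a) D)]
  refine add_le_add ?_ ?_
  · rw [← Finset.card_image_of_injective _ hz]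
    exact Finset.card_le_card hzm
  · split_ifs with hD
    · rw [← Finset.card_image_of_injective _ hs]
      refine Finset.card_le_card fun v hv => ?_
      obtain ⟨e, he, rfl⟩ := Finset.mem_image.1 hv
      rw [mem_boundedVectors hw] at he
      rw [Finset.mem_filter, mem_boundedVectors hw]
      simp only [Fintype.sum_option, Option.elim_none, Option.elim_some, s, mul_add, mul_one]
        at he ⊢
      omega
    · exact Nat.zero_le _

end Counting

/-- A function of polynomial growth cannot grow by a factor `A / B > 1` at each step. -/
theorem le_of_mul_le_mul_shift {U : ℕ → ℕ} {A B c s : ℕ} (hU0 : 0 < U 0)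
    (hU : ∀ D, U D ≤ (D + 1) ^ s) (h : ∀ D, A * U D ≤ B * U (D + c)) : A ≤ B := by
  by_contra! hlt
  have hB : 0 < B := by
    rcases Nat.eq_zero_or_pos B with rfl | hB
    · have := h 0
      simp at this
      omega
    · exact hB
  have hBR : (0 : ℝ) < B := by exact_mod_cast hB
  set q : ℝ := A / B with hq
  have hq1 : 1 < q := by
    rw [hq, one_lt_div hBR]
    exact_mod_cast hlt
  have hgrow : ∀ k : ℕ, q ^ k ≤ U (k * c) := by
    intro k
    induction k with
    | zero => simpa using Nat.one_le_iff_ne_zero.2 hU0.ne'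
    | succ k ih =>
      have h1 : (A : ℝ) * U (k * c) ≤ B * U ((k + 1) * c) := by
        have := h (k * c)
        rw [← Nat.succ_mul] at this
        exact_mod_cast this
      rw [pow_succ]
      calc q ^ k * q ≤ U (k * c) * q := by gcongr
        _ = (A * U (k * c)) / B := by rw [hq]; ring
        _ ≤ _ := by rw [div_le_iff₀ hBR]; linarith
  have hlim := tendsto_pow_const_div_const_pow_of_one_lt s hq1
  have hlim' := (hlim.comp (Filter.tendsto_add_atTop_nat 1)).mul_const (((c : ℝ) + 1) ^ s * q)
  rw [zero_mul] at hlim'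
  obtain ⟨k, hk⟩ := (hlim'.eventually (gt_mem_nhds one_pos)).exists
  have hqk : 0 < q ^ k := by positivity
  have hle : q ^ k ≤ (((k : ℝ) + 1) * (c + 1)) ^ s := by
    refine (hgrow k).trans ?_
    have h2 : (U (k * c) : ℝ) ≤ ((k : ℝ) * c + 1) ^ s := by exact_mod_cast hU (k * c)
    refine h2.trans ?_
    gcongr
    have : (0 : ℝ) ≤ k := by positivity
    have : (0 : ℝ) ≤ c := by positivity
    nlinarith
  simp only [Function.comp_apply, Nat.cast_add, Nat.cast_one] at hk
  rw [pow_succ, mul_pow] at *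
  have : ((k : ℝ) + 1) ^ s / (q ^ k * q) * ((c + 1) ^ s * q) =
      (((k : ℝ) + 1) ^ s * (c + 1) ^ s) / q ^ k := by
    field_simp
  rw [this, div_lt_one hqk] at hk
  linarith

/-- Comparing the leading coefficients in `W` of both sides. -/
theorem le_prod_of_forall_mul_pow_le {ι : Type*} [Fintype ι] {w : ι → ℕ} {S c : ℕ}
    (h : ∀ W : ℕ, 0 < W → S * W ^ Fintype.card ι ≤ ∏ i, (W * w i + c)) : S ≤ ∏ i, w i := by
  have hlim : Filter.Tendsto (fun W : ℕ => ∏ i, ((w i : ℝ) + c / W)) Filter.atTop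
      (nhds (∏ i, ((w i : ℝ) + 0))) :=
    tendsto_finsetProd _ fun i _ =>
      tendsto_const_nhds.add (tendsto_const_div_atTop_nhds_zero_nat _)
  have hle : (S : ℝ) ≤ ∏ i, ((w i : ℝ) + 0) := by
    refine ge_of_tendsto hlim ?_
    filter_upwards [Filter.eventually_gt_atTop 0] with W hW
    have hWR : (0 : ℝ) < W := by exact_mod_cast hW
    have h1 : (S : ℝ) * (W : ℝ) ^ Fintype.card ι ≤ ∏ i, ((W : ℝ) * w i + c) := by
      exact_mod_cast h W hW
    have h2 : ∏ i, ((W : ℝ) * w i + c) = (W : ℝ) ^ Fintype.card ι * ∏ i, ((w i : ℝ) + c / W) := by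
      rw [← Finset.card_univ, ← Finset.prod_const, ← Finset.prod_mul_distrib]
      exact Finset.prod_congr rfl fun i _ => by field_simp
    rw [h2, mul_comm] at h1
    exact le_of_mul_le_mul_left h1 (by positivity)
  simp only [add_zero] at hle
  exact_mod_cast hle

theorem weighted_mul_prod_le_prod {ι κ : Type*} [Fintype ι] [DecidableEq ι] [Fintype κ]
    [DecidableEq κ] (hcard : Fintype.card ι = Fintype.card κ + 1) {a : κ → ℕ} {b : ι → ℕ}
    (ha : ∀ i, 0 < a i) (hb : ∀ i, 0 < b i) {δ : ℕ} (hδ : 0 < δ)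
    (h : ∀ D, (boundedVectors b D).card ≤ (boundedVectors a D).card +
      if δ ≤ D then (boundedVectors b (D - δ)).card else 0) :
    δ * ∏ i, a i ≤ ∏ i, b i := by
  have hw : ∀ o : Option κ, 0 < o.elim δ a := by rintro (_ | i) <;> simp [hδ, ha]
  have key : ∀ D, (boundedVectors b D).card ≤
      (boundedVectors (fun o : Option κ => o.elim δ a) D).card := by
    intro D
    induction D using Nat.strong_induction_on with
    | _ D ih =>
      refine (h D).trans (le_trans ?_ (card_boundedVectors_option a ha hδ D))
      gcongr
      split_ifs with hD
      · exact ih _ (by omega)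
      · exact le_rfl
  let e : ι ≃ Option κ := Fintype.equivOfCardEq (by simp [hcard])
  have hprod : ∏ o : Option κ, o.elim δ a = δ * ∏ i, a i := by simp [Fintype.prod_option]
  rw [← hprod]
  refine le_of_mul_le_mul_shift (U := fun D => (boundedVectors (1 : ι → ℕ) D).card)
    (c := ∑ o : Option κ, o.elim δ a) (s := Fintype.card ι) ?_
    (card_boundedVectors_le_pow _) fun D => ?_
  · exact Finset.card_pos.2 ⟨0, (mem_boundedVectors (by simp)).2 (by simp)⟩
  · calc (∏ o : Option κ, o.elim δ a) * (boundedVectors (1 : ι → ℕ) D).card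
        ≤ (∏ o : Option κ, o.elim δ a) * ((∏ i, b i) * (boundedVectors b D).card) := by
          gcongr
          exact card_boundedVectors_one_le hb D
      _ ≤ (∏ o : Option κ, o.elim δ a) * ((∏ i, b i) *
            (boundedVectors (fun o : Option κ => o.elim δ a) D).card) := by
          gcongr
          exact key D
      _ = (∏ i, b i) * ((∏ o : Option κ, o.elim δ a) *
            (boundedVectors (fun o : Option κ => o.elim δ a) D).card) := by ring
      _ ≤ (∏ i, b i) *
            (boundedVectors (1 : Option κ → ℕ) (D + ∑ o : Option κ, o.elim δ a)).card := by
          gcongr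
          exact prod_mul_card_boundedVectors_le hw D
      _ = _ := by
          rw [← card_boundedVectors_comp_equiv e 1 (by simp)]
          rfl

section WeightedDegree

variable {K : Type*} [Field K] {σ ι : Type*} [Fintype σ] [Fintype ι]

/-- The polynomials of weighted total degree at most `D`. -/
noncomputable def weightedDegreeLE (K : Type*) [Field K] (w : σ → ℕ) (D : ℕ) :
    Submodule K (MvPolynomial σ K) :=
  restrictSupport K {m | ∑ i, w i * m i ≤ D}

theorem mem_weightedDegreeLE {w : σ → ℕ} {D : ℕ} {p : MvPolynomial σ K} :
    p ∈ weightedDegreeLE K w D ↔ ∀ m ∈ p.support, ∑ i, w i * m i ≤ D :=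
  mem_restrictSupport_iff K

theorem weightedDegreeLE_mono (w : σ → ℕ) {D D' : ℕ} (h : D ≤ D') :
    weightedDegreeLE K w D ≤ weightedDegreeLE K w D' :=
  restrictSupport_mono K fun _ hm => le_trans hm h

/-- The substitution `X i ↦ X i * t ^ w i`, which turns the weighted degree into the degree
in `t`. -/
noncomputable def weightGrading (K : Type*) [Field K] (w : σ → ℕ) :
    MvPolynomial σ K →ₐ[K] Polynomial (MvPolynomial σ K) :=
  aeval fun i => Polynomial.monomial (w i) (X i)

theorem weightGrading_monomial (w : σ → ℕ) (m : σ →₀ ℕ) (c : K) :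
    weightGrading K w (monomial m c) =
      Polynomial.monomial (∑ i, w i * m i) (monomial m c) := by
  have h : ∀ s : Finset σ, ∏ i ∈ s, Polynomial.monomial (w i) (X i : MvPolynomial σ K) ^ m i =
      Polynomial.monomial (∑ i ∈ s, w i * m i) (∏ i ∈ s, X i ^ m i) := by
    classical
    intro s
    induction s using Finset.induction_on with
    | empty => simp
    | insert i s hi ih =>
      rw [Finset.prod_insert hi, Finset.prod_insert hi, Finset.sum_insert hi, ih,
        Polynomial.monomial_pow, Polynomial.monomial_mul_monomial]
  rw [weightGrading, aeval_monomial, Finsupp.prod_fintype _ _ (by simp), h, monomial_eq (s := m),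
    Finsupp.prod_fintype _ _ (by simp), IsScalarTower.algebraMap_apply K (MvPolynomial σ K),
    Polynomial.algebraMap_apply, Algebra.algebraMap_self, RingHom.id_apply,
    Polynomial.C_mul_monomial]
  rfl

theorem coeff_coeff_weightGrading (w : σ → ℕ) (p : MvPolynomial σ K) (k : ℕ) (m : σ →₀ ℕ) :
    ((weightGrading K w p).coeff k).coeff m = if ∑ i, w i * m i = k then p.coeff m else 0 := by
  classical
  induction p using MvPolynomial.induction_on' with
  | monomial u c =>
    rw [weightGrading_monomial, Polynomial.coeff_monomial]
    by_cases hum : u = m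
    · subst hum
      split_ifs <;> simp
    · split_ifs <;> simp [hum]
  | add p q hp hq =>
    rw [map_add, Polynomial.coeff_add, coeff_add, hp, hq, coeff_add]
    split_ifs <;> simp

theorem weightGrading_ne_zero (w : σ → ℕ) {p : MvPolynomial σ K} (hp : p ≠ 0) :
    weightGrading K w p ≠ 0 := by
  obtain ⟨m, hm⟩ := ne_zero_iff.1 hp
  intro h
  have := coeff_coeff_weightGrading w p (∑ i, w i * m i) m
  simp only [h, if_true, Polynomial.coeff_zero, coeff_zero] at this
  exact hm this.symm

theorem le_natDegree_weightGrading (w : σ → ℕ) {p : MvPolynomial σ K} {m : σ →₀ ℕ}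
    (hm : m ∈ p.support) : ∑ i, w i * m i ≤ (weightGrading K w p).natDegree := by
  refine Polynomial.le_natDegree_of_ne_zero fun h => ?_
  have := coeff_coeff_weightGrading w p (∑ i, w i * m i) m
  rw [h, if_pos rfl, coeff_zero] at this
  exact mem_support_iff.1 hm this.symm

theorem mem_weightedDegreeLE_iff_natDegree {w : σ → ℕ} {D : ℕ} {p : MvPolynomial σ K} :
    p ∈ weightedDegreeLE K w D ↔ (weightGrading K w p).natDegree ≤ D := by
  rw [mem_weightedDegreeLE]
  refine ⟨fun h => Polynomial.natDegree_le_iff_coeff_eq_zero.2 fun k hk => ?_,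
    fun h m hm => (le_natDegree_weightGrading w hm).trans h⟩
  ext m
  rw [coeff_coeff_weightGrading, coeff_zero]
  split_ifs with hmk
  · by_contra hne
    have := h m (mem_support_iff.2 hne)
    omega
  · rfl

theorem mul_mem_weightedDegreeLE {w : σ → ℕ} {D E : ℕ} {p q : MvPolynomial σ K}
    (hp : p ∈ weightedDegreeLE K w D) (hq : q ∈ weightedDegreeLE K w E) :
    p * q ∈ weightedDegreeLE K w (D + E) := by
  rw [mem_weightedDegreeLE_iff_natDegree] at *
  rw [map_mul]
  exact Polynomial.natDegree_mul_le.trans (add_le_add hp hq)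

theorem C_mem_weightedDegreeLE (w : σ → ℕ) (D : ℕ) (c : K) :
    C c ∈ weightedDegreeLE K w D := by
  rw [mem_weightedDegreeLE_iff_natDegree, ← algebraMap_eq, AlgHom.commutes,
    IsScalarTower.algebraMap_apply K (MvPolynomial σ K), Polynomial.algebraMap_apply,
    Polynomial.natDegree_C]
  exact Nat.zero_le D

theorem X_mem_weightedDegreeLE (w : σ → ℕ) (i : σ) :
    (X i : MvPolynomial σ K) ∈ weightedDegreeLE K w (w i) := by
  rw [mem_weightedDegreeLE_iff_natDegree, weightGrading, aeval_X]
  exact Polynomial.natDegree_monomial_le _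

theorem le_of_mul_mem_weightedDegreeLE {w : σ → ℕ} {D : ℕ} {p q : MvPolynomial σ K}
    (h : p * q ∈ weightedDegreeLE K w D) (hq : q ≠ 0) {m : σ →₀ ℕ} (hm : m ∈ p.support) :
    ∑ i, w i * m i ≤ D ∧ q ∈ weightedDegreeLE K w (D - ∑ i, w i * m i) := by
  have hp : p ≠ 0 := by
    rintro rfl
    simp at hm
  rw [mem_weightedDegreeLE_iff_natDegree] at *
  rw [map_mul, Polynomial.natDegree_mul (weightGrading_ne_zero w hp)
    (weightGrading_ne_zero w hq)] at h
  have := le_natDegree_weightGrading w hm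
  omega

theorem aeval_mem_weightedDegreeLE {a : σ → ℕ} {b : ι → ℕ} {h : ι → MvPolynomial σ K}
    (hdeg : ∀ i, h i ∈ weightedDegreeLE K a (b i)) {D : ℕ} {p : MvPolynomial ι K}
    (hp : p ∈ weightedDegreeLE K b D) : aeval h p ∈ weightedDegreeLE K a D := by
  have hpow : ∀ i k, h i ^ k ∈ weightedDegreeLE K a (b i * k) := by
    intro i k
    induction k with
    | zero => simpa using C_mem_weightedDegreeLE a 0 (1 : K)
    | succ k ih =>
      rw [pow_succ, mul_add, mul_one]
      exact mul_mem_weightedDegreeLE ih (hdeg i)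
  have hprod : ∀ (m : ι →₀ ℕ) (s : Finset ι),
      ∏ i ∈ s, h i ^ m i ∈ weightedDegreeLE K a (∑ i ∈ s, b i * m i) := by
    classical
    intro m s
    induction s using Finset.induction_on with
    | empty => simpa using C_mem_weightedDegreeLE a 0 (1 : K)
    | insert i s hi ih =>
      rw [Finset.prod_insert hi, Finset.sum_insert hi]
      exact mul_mem_weightedDegreeLE (hpow _ _) ih
  rw [mem_weightedDegreeLE] at hp
  rw [aeval_def, eval₂_eq']
  refine Submodule.sum_mem _ fun m hm => ?_
  rw [← Algebra.smul_def]
  exact Submodule.smul_mem _ _ (weightedDegreeLE_mono a (hp m hm) (hprod m _))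

variable [DecidableEq σ] [DecidableEq ι]

theorem natCard_weightedSupport {w : σ → ℕ} (hw : ∀ i, 0 < w i) (D : ℕ) :
    Nat.card {m : σ →₀ ℕ | ∑ i, w i * m i ≤ D} = (boundedVectors w D).card := by
  rw [← Nat.card_eq_finsetCard]
  exact Nat.card_congr (Finsupp.equivFunOnFinite.subtypeEquiv fun m => by
    rw [mem_boundedVectors hw]
    rfl)

theorem finrank_weightedDegreeLE {w : σ → ℕ} (hw : ∀ i, 0 < w i) (D : ℕ) :
    Module.finrank K (weightedDegreeLE K w D) = (boundedVectors w D).card := by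
  rw [← natCard_weightedSupport hw]
  exact Module.finrank_eq_nat_card_basis (basisRestrictSupport K _)

theorem finite_weightedDegreeLE {w : σ → ℕ} (hw : ∀ i, 0 < w i) (D : ℕ) :
    Module.Finite K (weightedDegreeLE K w D) := by
  have : Finite {m : σ →₀ ℕ | ∑ i, w i * m i ≤ D} := by
    refine Nat.finite_of_card_ne_zero ?_
    rw [natCard_weightedSupport hw]
    exact (Finset.card_pos.2 ⟨0, (mem_boundedVectors hw).2 (by simp)⟩).ne'
  exact Module.Finite.of_basis (basisRestrictSupport K _)

/-- A weighted form of Perron's theorem: if `#σ + 1` polynomials in the variables `σ` satisfy,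
up to multiples, a single algebraic relation `P`, then the weighted degree of `P` satisfies a
Bézout bound. -/
theorem weight_mul_prod_le_of_dvd (hcard : Fintype.card ι = Fintype.card σ + 1)
    {a : σ → ℕ} {b : ι → ℕ} (ha : ∀ i, 0 < a i) (hb : ∀ i, 0 < b i)
    {h : ι → MvPolynomial σ K} (hdeg : ∀ i, h i ∈ weightedDegreeLE K a (b i))
    {P : MvPolynomial ι K} (hP : ∀ Q, aeval h Q = 0 → P ∣ Q) {m : ι →₀ ℕ} (hm : m ∈ P.support) :
    (∑ i, b i * m i) * ∏ i, a i ≤ ∏ i, b i := by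
  rcases Nat.eq_zero_or_pos (∑ i, b i * m i) with h0 | hδ
  · simp [h0]
  refine weighted_mul_prod_le_prod hcard ha hb hδ fun D => ?_
  have := finite_weightedDegreeLE (K := K) hb D
  have := finite_weightedDegreeLE (K := K) ha D
  let φ : weightedDegreeLE K b D →ₗ[K] MvPolynomial σ K :=
    (aeval h).toLinearMap.domRestrict (weightedDegreeLE K b D)
  have hrange : LinearMap.range φ ≤ weightedDegreeLE K a D := by
    rintro _ ⟨q, rfl⟩
    exact aeval_mem_weightedDegreeLE hdeg q.2
  rw [← finrank_weightedDegreeLE (K := K) hb D, ← finrank_weightedDegreeLE (K := K) ha D,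
    ← LinearMap.finrank_range_add_finrank_ker φ]
  refine add_le_add (Submodule.finrank_mono hrange) ?_
  have hker : ∀ q ∈ LinearMap.ker φ, ∃ q', (q : MvPolynomial ι K) = P * q' := fun q hq => hP _ hq
  split_ifs with hD
  · rw [← finrank_weightedDegreeLE (K := K) hb, ← Submodule.finrank_map_subtype_eq]
    have := finite_weightedDegreeLE (K := K) hb (D - ∑ i, b i * m i)
    refine (Submodule.finrank_mono (t := (weightedDegreeLE K b (D - ∑ i, b i * m i)).map
      (LinearMap.mulLeft K P)) ?_).trans (Submodule.finrank_map_le _ _)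
    rintro _ ⟨q, hq, rfl⟩
    obtain ⟨q', hq'⟩ := hker q hq
    refine ⟨q', ?_, hq'.symm⟩
    by_cases hq0 : q' = 0
    · simp [hq0]
    · exact (le_of_mul_mem_weightedDegreeLE (hq' ▸ q.2) hq0 hm).2
  · have hbot : LinearMap.ker φ = ⊥ := by
      refine (Submodule.eq_bot_iff _).2 fun q hq => ?_
      obtain ⟨q', hq'⟩ := hker q hq
      by_cases hq0 : q' = 0
      · exact Subtype.ext (by simp [hq', hq0])
      · exact absurd (le_of_mul_mem_weightedDegreeLE (hq' ▸ q.2) hq0 hm).1 hD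
    rw [hbot, finrank_bot]

end WeightedDegree

section LieDegree

variable {K : Type*} [Field K] {r n : ℕ}

theorem mem_weightedDegreeLE_elim_iff {p : MvPolynomial (Fin r ⊕ Fin n) K} {d : ℕ} :
    p ∈ weightedDegreeLE K (Sum.elim 0 1) d ↔ degXv p ≤ d := by
  simp [mem_weightedDegreeLE, degXv]

theorem mem_weightedDegreeLE_of_degMu_degXv {p : MvPolynomial (Fin r ⊕ Fin n) K} {c d : ℕ}
    (hc : degMu p ≤ c) (hd : degXv p ≤ d) (W : ℕ) :
    p ∈ weightedDegreeLE K (Sum.elim 1 fun _ => W) (W * d + c) := by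
  rw [mem_weightedDegreeLE]
  intro m hm
  have h1 : ∑ j : Fin r, m (Sum.inl j) ≤ c := Finset.sup_le_iff.1 hc m hm
  have h2 : ∑ i : Fin n, m (Sum.inr i) ≤ d := Finset.sup_le_iff.1 hd m hm
  have h3 := Nat.mul_le_mul_left W h2
  simp only [Fintype.sum_sum_type, Sum.elim_inl, Sum.elim_inr, Pi.one_apply, one_mul,
    ← Finset.mul_sum]
  omega

/-- A derivation constant on the `μ` and mapping constants to constants raises the degree in `x`
by at most `E` if it maps each `x`-variable to a polynomial of degree at most `E + 1`. -/
theorem degXv_derivation_le [CharZero K]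
    {L : Derivation ℚ (MvPolynomial (Fin r ⊕ Fin n) K) (MvPolynomial (Fin r ⊕ Fin n) K)} {E : ℕ}
    (hLx : ∀ i, degXv (L (X (Sum.inr i))) ≤ E + 1) (hLmu : ∀ j, L (X (Sum.inl j)) = 0)
    (hLC : ∀ c : K, ∃ c' : K, L (C c) = C c') (p : MvPolynomial (Fin r ⊕ Fin n) K) :
    degXv (L p) ≤ degXv p + E := by
  let w : Fin r ⊕ Fin n → ℕ := Sum.elim 0 1
  let N : ((Fin r ⊕ Fin n) →₀ ℕ) → Prop := fun m =>
    ∀ c : K, L (monomial m c) ∈ weightedDegreeLE K w ((∑ i, w i * m i) + E)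
  have hself : ∀ (m : (Fin r ⊕ Fin n) →₀ ℕ) (c : K),
      monomial m c ∈ weightedDegreeLE K w (∑ i, w i * m i) := fun m c => by
    refine mem_weightedDegreeLE.2 fun m' hm' => ?_
    rw [Finset.mem_singleton.1 (support_monomial_subset hm')]
  have hzero : N 0 := fun c => by
    obtain ⟨c', hc'⟩ := hLC c
    change L (C c) ∈ _
    rw [hc']
    exact C_mem_weightedDegreeLE _ _ _
  have hadd : ∀ m m', N m → N m' → N (m + m') := fun m m' hm hm' c => by
    have hmul : monomial (m + m') c = monomial m c * monomial m' (1 : K) := by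
      rw [monomial_mul, mul_one]
    have hsum : ∑ i, w i * (m + m') i = (∑ i, w i * m i) + ∑ i, w i * m' i := by
      simp only [Finsupp.add_apply, mul_add, Finset.sum_add_distrib]
    rw [hmul, Derivation.leibniz, smul_eq_mul, smul_eq_mul, hsum]
    refine Submodule.add_mem _ ?_ ?_
    · exact weightedDegreeLE_mono w (by omega) (mul_mem_weightedDegreeLE (hself m c) (hm' 1))
    · exact weightedDegreeLE_mono w (by omega) (mul_mem_weightedDegreeLE (hself m' 1) (hm c))
  have hX : ∀ i, L (X i) ∈ weightedDegreeLE K w (w i + E) := by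
    rintro (j | i)
    · rw [hLmu]
      exact Submodule.zero_mem _
    · refine mem_weightedDegreeLE_elim_iff.2 ((hLx i).trans ?_)
      simp [w, add_comm]
  have hsingle : ∀ i, N (Finsupp.single i 1) := fun i c => by
    obtain ⟨c', hc'⟩ := hLC c
    have hsum : ∑ j, w j * Finsupp.single i 1 j = w i := by
      simp [Finsupp.single_apply]
    rw [hsum, ← C_mul_X_eq_monomial, Derivation.leibniz, smul_eq_mul, smul_eq_mul, hc']
    refine Submodule.add_mem _ ?_ ?_
    · simpa using mul_mem_weightedDegreeLE (C_mem_weightedDegreeLE w 0 c) (hX i)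
    · exact mul_mem_weightedDegreeLE (X_mem_weightedDegreeLE w i) (C_mem_weightedDegreeLE w E c')
  have hmon : ∀ m, N m := fun m => by
    induction m using Finsupp.induction_linear with
    | zero => exact hzero
    | add m m' hm hm' => exact hadd m m' hm hm'
    | single i k =>
      induction k with
      | zero => simpa using hzero
      | succ k ih =>
        rw [Finsupp.single_add]
        exact hadd _ _ ih (hsingle i)
  rw [← mem_weightedDegreeLE_elim_iff, p.as_sum, map_sum]
  refine Submodule.sum_mem _ fun m hm => weightedDegreeLE_mono _ ?_ (hmon m _)
  gcongr
  rw [← p.as_sum]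
  exact mem_weightedDegreeLE.1 (mem_weightedDegreeLE_elim_iff.2 le_rfl) m hm

theorem degXv_iterate_le [CharZero K]
    {L : Derivation ℚ (MvPolynomial (Fin r ⊕ Fin n) K) (MvPolynomial (Fin r ⊕ Fin n) K)} {E : ℕ}
    (hLx : ∀ i, degXv (L (X (Sum.inr i))) ≤ E + 1) (hLmu : ∀ j, L (X (Sum.inl j)) = 0)
    (hLC : ∀ c : K, ∃ c' : K, L (C c) = C c') (p : MvPolynomial (Fin r ⊕ Fin n) K) (k : ℕ) :
    degXv (L^[k] p) ≤ degXv p + k * E := by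
  induction k with
  | zero => simp
  | succ k ih =>
    rw [Function.iterate_succ_apply', add_one_mul]
    have := degXv_derivation_le hLx hLmu hLC (L^[k] p)
    omega

end LieDegree

section Algebraic

variable {K R : Type*} [Field K] [CommRing R] [Algebra K R]

/-- If the relations between the `h i` are the multiples of `P`, this remains true after adjoining
elements that are algebraically independent over the `h i`. -/
theorem rename_dvd_of_aeval_sumElim_eq_zero {ι J : Type*} {h : ι → R} {P : MvPolynomial ι K}
    (hP : ∀ Q, aeval h Q = 0 → P ∣ Q) {z : J → R}
    (hz : AlgebraicIndependent (aeval h : MvPolynomial ι K →ₐ[K] R).range z)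
    (Q : MvPolynomial (J ⊕ ι) K) (hQ : aeval (Sum.elim z h) Q = 0) :
    rename Sum.inr P ∣ Q := by
  set φ : MvPolynomial ι K →ₐ[K] R := aeval h with hφ
  have hcomp : ∀ q : MvPolynomial (J ⊕ ι) K, aeval (Sum.elim z h) q =
      aeval z (map (φ.rangeRestrict : MvPolynomial ι K →+* φ.range) (sumAlgEquiv K J ι q)) := by
    intro q
    induction q using MvPolynomial.induction_on with
    | C c =>
      rw [sumAlgEquiv_C_inl, map_C, aeval_C, aeval_C]
      simp [Subalgebra.algebraMap_eq]
    | add p q hp hq => rw [map_add, map_add, map_add, map_add, hp, hq]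
    | mul_X p i hp =>
      rw [map_mul, map_mul, map_mul, map_mul, hp]
      congr 1
      rcases i with j | i
      · rw [sumAlgEquiv_X_inl, map_X, aeval_X, aeval_X, Sum.elim_inl]
      · rw [sumAlgEquiv_X_inr, map_C, aeval_C, aeval_X, Sum.elim_inr]
        simp [Subalgebra.algebraMap_eq, hφ]
  rw [hcomp] at hQ
  have hzero := hz.eq_zero_of_aeval_eq_zero _ hQ
  have hdvd : C P ∣ sumAlgEquiv K J ι Q := by
    rw [C_dvd_iff_dvd_coeff]
    intro m
    refine hP _ ?_
    have := congrArg (coeff m) hzero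
    rw [coeff_map, coeff_zero] at this
    exact congrArg Subtype.val this
  have := map_dvd (sumAlgEquiv K J ι).symm hdvd
  rw [AlgEquiv.symm_apply_apply] at this
  convert this
  rw [AlgEquiv.eq_symm_apply]
  exact DFunLike.congr_fun (sumAlgEquiv_comp_rename_inr K J ι) P

theorem isAlgebraic_of_eq_top {S A : Type*} [CommRing S] [CommRing A] [Nontrivial A] [Algebra S A]
    {B : Subalgebra S A} (hB : B = ⊤) : Algebra.IsAlgebraic B A :=
  have : Nontrivial B := inferInstance
  ⟨fun a => isAlgebraic_algebraMap (⟨a, hB ▸ Algebra.mem_top⟩ : B)⟩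

end Algebraic

/-- If `μ, y₀, …, y_{ν-1}` are algebraically independent and `μ, y₀, …, y_ν` are not, then `n - ν`
of the variables `x` are algebraically independent over the algebra generated by the latter. -/
theorem exists_algebraicIndependent_X_comp {K : Type*} [Field K] {r n ν : ℕ}
    (y : Fin (ν + 1) → MvPolynomial (Fin r ⊕ Fin n) K)
    (hind : AlgebraicIndependent K
      (Sum.elim (fun j => X (Sum.inl j)) fun k : Fin ν => y k.castSucc :
        Fin r ⊕ Fin ν → MvPolynomial (Fin r ⊕ Fin n) K))
    (hdep : ¬ AlgebraicIndependent K (Sum.elim (fun j => X (Sum.inl j)) y)) :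
    ν ≤ n ∧ ∃ z : Fin (n - ν) → Fin n, AlgebraicIndependent
      (aeval (Sum.elim (fun j => X (Sum.inl j)) y) :
        MvPolynomial (Fin r ⊕ Fin (ν + 1)) K →ₐ[K] MvPolynomial (Fin r ⊕ Fin n) K).range
      (fun i => (X (Sum.inr (z i)) : MvPolynomial (Fin r ⊕ Fin n) K)) := by
  set h : Fin r ⊕ Fin (ν + 1) → MvPolynomial (Fin r ⊕ Fin n) K :=
    Sum.elim (fun j => X (Sum.inl j)) y with hh
  set A := (aeval h : MvPolynomial (Fin r ⊕ Fin (ν + 1)) K →ₐ[K] _).range with hA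
  let h' : Fin r ⊕ Fin (ν + 1) → A := fun i => ⟨h i, X i, by simp⟩
  have hadj : Algebra.adjoin K (Set.range h') = ⊤ := by
    rw [Algebra.adjoin_range_eq_range_aeval, eq_top_iff]
    rintro ⟨_, q, rfl⟩ _
    refine ⟨q, Subtype.ext ?_⟩
    change A.val (aeval h' q) = aeval h q
    rw [comp_aeval_apply]
    rfl
  have hle : Algebra.trdeg K A ≤ (r + ν : ℕ) := by
    by_contra! hlt
    have : Algebra.IsAlgebraic (Algebra.adjoin K (Set.range h')) A :=
      isAlgebraic_of_eq_top hadj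
    have hbasis := Algebra.IsAlgebraic.isTranscendenceBasis_of_lift_le_trdeg_of_finite K h' (by
      simpa [add_assoc] using Cardinal.add_one_le_of_lt hlt)
    exact hdep (hbasis.1.map' (f := A.val) Subtype.val_injective)
  have hge : ((r + ν : ℕ) : Cardinal) ≤ Algebra.trdeg K A := by
    have hv : AlgebraicIndependent K
        (h' ∘ Sum.map id Fin.castSucc : Fin r ⊕ Fin ν → A) := by
      refine AlgebraicIndependent.of_comp A.val ?_
      convert hind using 1
      ext i : 1
      rcases i with i | i <;> rfl
    simpa using hv.lift_cardinalMk_le_trdeg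
  have htotal := trdeg_add_eq K A (A := MvPolynomial (Fin r ⊕ Fin n) K)
  rw [MvPolynomial.trdeg_of_isDomain, le_antisymm hle hge] at htotal
  have hadjX : Algebra.adjoin A
      (Set.range fun i : Fin n => (X (Sum.inr i) : MvPolynomial (Fin r ⊕ Fin n) K)) = ⊤ := by
    refine eq_top_iff.2 fun p _ => ?_
    induction p using MvPolynomial.induction_on with
    | C c => exact Subalgebra.algebraMap_mem _ (algebraMap K A c)
    | add p q hp hq => exact add_mem (hp trivial) (hq trivial)
    | mul_X p i hp =>
      refine mul_mem (hp trivial) ?_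
      rcases i with j | i
      · exact Subalgebra.algebraMap_mem _ (h' (Sum.inl j))
      · exact Algebra.subset_adjoin ⟨i, rfl⟩
  have : Algebra.IsAlgebraic (Algebra.adjoin A
      (Set.range fun i : Fin n => (X (Sum.inr i) : MvPolynomial (Fin r ⊕ Fin n) K)))
      (MvPolynomial (Fin r ⊕ Fin n) K) :=
    isAlgebraic_of_eq_top hadjX
  obtain ⟨t, ht, htb⟩ := exists_isTranscendenceBasis_subset (R := A)
    (Set.range fun i : Fin n => (X (Sum.inr i) : MvPolynomial (Fin r ⊕ Fin n) K))
  rw [← htb.cardinalMk_eq_trdeg] at htotal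
  have hfin : t.Finite := (Set.finite_range _).subset ht
  have := hfin.to_subtype
  have hcard : r + ν + Nat.card t = r + n := by
    rw [← Nat.cast_card] at htotal
    simp at htotal
    exact_mod_cast htotal
  have hnc : Nat.card t = n - ν := by omega
  refine ⟨by omega, ?_⟩
  let e : Fin (n - ν) ≃ t := (finCongr hnc.symm).trans (Finite.equivFin t).symm
  choose z hz using fun i => ht (e i).2
  refine ⟨z, ?_⟩
  have := htb.1.comp e e.injective
  convert this using 1
  ext i : 1
  exact hz i

theorem stmt2 {K : Type*} [Field K] [CharZero K] {r n : ℕ} (hn : 1 ≤ n)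
    (g : Fin n → MvPolynomial (Fin r ⊕ Fin n) K) (f : MvPolynomial (Fin r ⊕ Fin n) K)
    (L : Derivation ℚ (MvPolynomial (Fin r ⊕ Fin n) K) (MvPolynomial (Fin r ⊕ Fin n) K))
    (hLx : ∀ i, L (X (Sum.inr i)) = g i)
    (hLmu : ∀ j, L (X (Sum.inl j)) = 0)
    (hLC : ∀ c : K, ∃ c' : K, L (C c) = C c')
    (dmu dx Dmu Dx : ℕ)
    (hdmu : dmu = degMu f) (hdx : dx = degXv f)
    (hDmu : Dmu = Finset.univ.sup fun i => degMu (g i))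
    (hDx : Dx = Finset.univ.sup fun i => degXv (g i))
    (hdx1 : 1 ≤ dx) (hDx1 : 1 ≤ Dx)
    (ν : ℕ)
    (hinj : ∀ ν' < ν, RingHom.ker (liePhi f L ν') = ⊥)
    (P : MvPolynomial (Fin r ⊕ Fin (ν + 1)) K) (hP0 : P ≠ 0)
    (hPgen : RingHom.ker (liePhi f L ν) = Ideal.span {P}) :
    ∀ m ∈ P.support,
      (∑ i : Fin (ν + 1), (dx + (i : ℕ) * (Dx - 1)) * m (Sum.inr i)) ≤
        ∏ i : Fin (ν + 1), (dx + (i : ℕ) * (Dx - 1)) := by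
  intro m hm
  set y : Fin (ν + 1) → MvPolynomial (Fin r ⊕ Fin n) K := fun k => L^[(k : ℕ)] f with hy
  have hdvd : ∀ Q, aeval (Sum.elim (fun j => X (Sum.inl j)) y) Q = 0 → P ∣ Q := fun Q hQ => by
    rw [← Ideal.mem_span_singleton, ← hPgen]
    exact hQ
  have hdep : ¬ AlgebraicIndependent K (Sum.elim (fun j => X (Sum.inl j)) y) := fun hind => by
    refine hP0 (hind.eq_zero_of_aeval_eq_zero P ?_)
    have hP : P ∈ RingHom.ker (liePhi f L ν) := hPgen ▸ Ideal.mem_span_singleton_self P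
    exact hP
  have hind : AlgebraicIndependent K
      (Sum.elim (fun j => X (Sum.inl j)) fun k : Fin ν => y k.castSucc :
        Fin r ⊕ Fin ν → MvPolynomial (Fin r ⊕ Fin n) K) := by
    cases ν with
    | zero =>
      have hX := (algebraicIndependent_X (Fin r ⊕ Fin n) K).comp
        (Sum.elim Sum.inl Fin.elim0 : Fin r ⊕ Fin 0 → Fin r ⊕ Fin n) (by
          rintro (i | i) (j | j) hij
          · simpa using hij
          · exact j.elim0
          · exact i.elim0
          · exact i.elim0)
      convert hX using 1
      ext i : 1
      rcases i with i | i
      · rfl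
      · exact i.elim0
    | succ ν' =>
      rw [algebraicIndependent_iff_injective_aeval]
      exact (RingHom.injective_iff_ker_eq_bot _).2 (hinj ν' ν'.lt_succ_self)
  obtain ⟨hνn, z, hz⟩ := exists_algebraicIndependent_X_comp y hind hdep
  have hdegX : ∀ k : Fin (ν + 1), degXv (y k) ≤ dx + (k : ℕ) * (Dx - 1) := fun k => by
    rw [hdx]
    refine degXv_iterate_le (fun i => ?_) hLmu hLC f k
    rw [hLx, Nat.sub_add_cancel hDx1, hDx]
    exact Finset.le_sup (f := fun i => degXv (g i)) (Finset.mem_univ i)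
  set w : Fin (ν + 1) → ℕ := fun k => dx + (k : ℕ) * (Dx - 1) with hw
  set c : ℕ := Finset.univ.sup fun k => degMu (y k) with hc
  refine le_prod_of_forall_mul_pow_le (c := c) fun W hW => ?_
  let a : Fin r ⊕ Fin n → ℕ := Sum.elim 1 fun _ => W
  let b : Fin (n - ν) ⊕ (Fin r ⊕ Fin (ν + 1)) → ℕ :=
    Sum.elim (fun _ => W) (Sum.elim 1 fun k => W * w k + c)
  have ha : ∀ i, 0 < a i := by rintro (i | i) <;> simp [a, hW]
  have hb : ∀ i, 0 < b i := by
    rintro (i | i | i)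
    · exact hW
    · exact one_pos
    · have : 0 < W * w i := Nat.mul_pos hW (by simp only [hw]; omega)
      exact Nat.add_pos_left this c
  have hcard : Fintype.card (Fin (n - ν) ⊕ (Fin r ⊕ Fin (ν + 1))) =
      Fintype.card (Fin r ⊕ Fin n) + 1 := by
    simp only [Fintype.card_sum, Fintype.card_fin]
    omega
  have hm' : m.mapDomain Sum.inr ∈
      (rename (Sum.inr : _ → Fin (n - ν) ⊕ (Fin r ⊕ Fin (ν + 1))) P).support := by
    rw [mem_support_iff, coeff_rename_mapDomain _ Sum.inr_injective]
    exact mem_support_iff.1 hm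
  have hbound := weight_mul_prod_le_of_dvd hcard ha hb
    (h := Sum.elim (fun i => X (Sum.inr (z i))) (Sum.elim (fun j => X (Sum.inl j)) y)) (by
      rintro (i | j | k)
      · exact X_mem_weightedDegreeLE a (Sum.inr (z i))
      · exact X_mem_weightedDegreeLE a (Sum.inl j)
      · exact mem_weightedDegreeLE_of_degMu_degXv
          (Finset.le_sup (f := fun k => degMu (y k)) (Finset.mem_univ k)) (hdegX k) W)
    (rename_dvd_of_aeval_sumElim_eq_zero hdvd hz) hm'
  have hweight : W * ∑ k, w k * m (Sum.inr k) ≤ ∑ i, b i * m.mapDomain Sum.inr i := by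
    have hinr : ∀ i, (m.mapDomain (Sum.inr : _ → Fin (n - ν) ⊕ _)) (Sum.inr i) = m i :=
      fun i => Finsupp.mapDomain_apply Sum.inr_injective m i
    simp only [Fintype.sum_sum_type, b, Sum.elim_inl, Sum.elim_inr, hinr]
    rw [Finset.mul_sum]
    refine le_trans (Finset.sum_le_sum fun k _ => ?_)
      ((Nat.le_add_left _ _).trans (Nat.le_add_left _ _))
    rw [← mul_assoc]
    exact Nat.mul_le_mul_right _ (Nat.le_add_right _ _)
  have hle := (Nat.mul_le_mul_right (∏ i, a i) hweight).trans hbound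
  simp only [Fintype.prod_sum_type, a, b, Sum.elim_inl, Sum.elim_inr, Pi.one_apply,
    Finset.prod_const_one, one_mul, Finset.prod_const, Finset.card_univ, Fintype.card_fin] at hle
  rw [Fintype.card_fin]
  refine Nat.le_of_mul_le_mul_left (le_trans (le_of_eq ?_) hle) (pow_pos hW (n - ν))
  obtain ⟨d, rfl⟩ := Nat.exists_eq_add_of_le hνn
  rw [Nat.add_sub_cancel_left]
  ring
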